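/- Let 0 < a ≤ 1/2 and for k > 0, δ > 0 define J_a(t) := (1/(2π)) ∫_{t−k}^{t+k} | π^{−1/4−iu/4} Γ((1+2iu)/4) Q(1/2 + iu, a) e^{πu/4} e^{−uδ/2} | du. There exist positive constants c and u₀ (independent of k and δ) such that for all k > 0, δ > 0, and all t with t − k ≥ u₀, J_a(t) ≥ c · (t+k)^{−1/4} · e^{−(t+k)δ/2} · ∫_{t−k}^{t+k} | Q(1/2 + iu, a) | du. -/

import Mathlib

open Complex MeasureTheory

/-- The Hurwitz zeta function `ζ(s, a)`. -/
noncomputable def hzeta (a : ℝ) (s : ℂ) : ℂ := HurwitzZeta.hurwitzZeta (a : UnitAddCircle) s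

/-- The periodic (exponential) zeta function `Li(s, a)`. -/
noncomputable def pzeta (a : ℝ) (s : ℂ) : ℂ := HurwitzZeta.expZeta (a : UnitAddCircle) s

/-- The quadrilateral zeta function `Q(s, a)`, defined by
`2Q(s,a) = ζ(s,a) + ζ(s,1−a) + Li(s,a) + Li(s,1−a)`. -/
noncomputable def Qzeta (s : ℂ) (a : ℝ) : ℂ :=
  (hzeta a s + hzeta (1 - a) s + pzeta a s + pzeta (1 - a) s) / 2

/-- The integral `J_a(t)`. -/
noncomputable def Jfun (a : ℝ) (k δ t : ℝ) : ℝ :=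
  (1 / (2 * Real.pi)) *
    ∫ u in (t - k)..(t + k),
      ‖((Real.pi : ℂ) ^ (-(1 : ℂ) / 4 - Complex.I * u / 4) *
        Complex.Gamma ((1 + 2 * Complex.I * u) / 4) * Qzeta (1 / 2 + Complex.I * u) a *
        Complex.exp (Real.pi * u / 4) * Complex.exp (-u * δ / 2))‖

lemma aux_re (x y : ℝ) : ((x : ℂ) + (y : ℂ) * I).re = x := by simp

lemma aux_sin_norm (z : ℂ) : ‖Complex.sin z‖ ≤ Real.exp |z.im| := by
  have h : Complex.sin z = (Complex.exp (-z * I) - Complex.exp (z * I)) * I / 2 := rfl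
  rw [h, norm_div, norm_mul, Complex.norm_I, mul_one]
  have h1 : ‖Complex.exp (-z * I)‖ ≤ Real.exp |z.im| := by
    rw [Complex.norm_exp]
    apply Real.exp_le_exp.mpr
    simpa using le_abs_self z.im
  have h2 : ‖Complex.exp (z * I)‖ ≤ Real.exp |z.im| := by
    rw [Complex.norm_exp]
    apply Real.exp_le_exp.mpr
    simpa using neg_le_abs z.im
  have h3 := norm_sub_le (Complex.exp (-z * I)) (Complex.exp (z * I))
  have : ‖(2 : ℂ)‖ = 2 := by simp
  rw [this]
  linarith

lemma aux_refl (s : ℂ) (h : Complex.sin (Real.pi * s) ≠ 0) :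
    Real.pi * Real.exp (-(Real.pi * |s.im|)) ≤ ‖Complex.Gamma s‖ * ‖Complex.Gamma (1 - s)‖ := by
  rw [← norm_mul, Complex.Gamma_mul_Gamma_one_sub, norm_div]
  have h1 := aux_sin_norm (Real.pi * s)
  have h2 : |((Real.pi : ℂ) * s).im| = Real.pi * |s.im| := by
    simp [abs_mul, abs_of_pos Real.pi_pos]
  rw [h2] at h1
  have h3 : ‖(Real.pi : ℂ)‖ = Real.pi := by simp [abs_of_pos Real.pi_pos]
  rw [h3, Real.exp_neg, ← div_eq_mul_inv]
  exact div_le_div_of_nonneg_left Real.pi_pos.le (norm_pos_iff.mpr h) h1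

lemma aux_sin_ne (s : ℂ) (h : s.im ≠ 0) : Complex.sin (Real.pi * s) ≠ 0 := by
  intro h0
  rw [Complex.sin_eq_zero_iff] at h0
  obtain ⟨k, hk⟩ := h0
  have := congrArg Complex.im hk
  simp [Real.pi_ne_zero, h] at this

lemma aux_half (y : ℝ) (hy : 0 < y) :
    Real.pi * Real.exp (-(Real.pi * y)) ≤ ‖Complex.Gamma (1 / 2 + I * y)‖ ^ 2 := by
  have h := aux_refl (1 / 2 + I * y) (aux_sin_ne _ (by simp [hy.ne']))
  have e : (1 : ℂ) - (1 / 2 + I * y) = (starRingEnd ℂ) (1 / 2 + I * y) := by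
    apply Complex.ext <;> simp
    norm_num
  rw [e, Complex.Gamma_conj, RCLike.norm_conj] at h
  simpa [abs_of_pos hy, sq] using h

lemma aux_zero (y : ℝ) (hy : 0 < y) :
    Real.pi * Real.exp (-(Real.pi * y)) / y ≤ ‖Complex.Gamma (I * y)‖ ^ 2 := by
  have h := aux_refl (I * y) (aux_sin_ne _ (by simp [hy.ne']))
  have e : (1 : ℂ) - (I * y) = (starRingEnd ℂ) (I * y) + 1 := by
    apply Complex.ext <;> simp
  rw [e, Complex.Gamma_add_one _ (by simp [hy.ne']), norm_mul, Complex.Gamma_conj,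
    RCLike.norm_conj, RCLike.norm_conj] at h
  rw [div_le_iff₀ hy]
  simp [abs_of_pos hy] at h
  simp only [sq]
  linarith

lemma aux_factor (y : ℝ) (hy : 1 / 4 ≤ y) (j : ℕ) (hj : 1 ≤ j) :
    (1 - 1 / ((j : ℝ) + 1) ^ 2) * (((1 / 4 + j : ℝ) ^ 2 + y ^ 2) ^ 2) ≤
      ((j : ℝ) ^ 2 + y ^ 2) * ((1 / 2 + j : ℝ) ^ 2 + y ^ 2) := by
  have hj' : (1 : ℝ) ≤ j := by exact_mod_cast hj
  set m : ℝ := 1 / 4 + j with hm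
  have h1 : (m ^ 2 + y ^ 2) / 8 ≤ (m ^ 2 + y ^ 2) ^ 2 / ((j : ℝ) + 1) ^ 2 := by
    rw [div_le_div_iff₀ (by norm_num) (by positivity)]
    have : ((j : ℝ) + 1) ^ 2 ≤ (m ^ 2 + y ^ 2) * 8 := by nlinarith
    nlinarith [mul_le_mul_of_nonneg_left this (by positivity : 0 ≤ m ^ 2 + y ^ 2)]
  have h2 : ((j : ℝ) ^ 2 + y ^ 2) * ((1 / 2 + j : ℝ) ^ 2 + y ^ 2) =
      (m ^ 2 + y ^ 2) ^ 2 + (y ^ 2 - m ^ 2) / 8 + 1 / 256 := by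
    rw [hm]; ring
  rw [h2, sub_mul, one_mul, div_mul_eq_mul_div, one_mul]
  nlinarith [sq_nonneg y]

lemma aux_prod (y : ℝ) (hy : 1 / 4 ≤ y) (n : ℕ) :
    (1 / 2 * ((n + 2 : ℝ) / (n + 1))) *
      ∏ j ∈ Finset.range (n + 1), (((1 / 4 + j : ℝ) ^ 2 + y ^ 2) ^ 2) ≤
      ∏ j ∈ Finset.range (n + 1), (((j : ℝ) ^ 2 + y ^ 2) * ((1 / 2 + j : ℝ) ^ 2 + y ^ 2)) := by
  induction n with
  | zero =>
    simp
    nlinarith [sq_nonneg y]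
  | succ n ih =>
    rw [Finset.prod_range_succ, Finset.prod_range_succ _ (n + 1)]
    have hf := aux_factor y hy (n + 1) (by omega)
    refine le_trans (le_of_eq ?_) (mul_le_mul ih hf ?_ ?_)
    · push_cast
      field_simp
      ring
    · apply mul_nonneg
      · rw [sub_nonneg, div_le_one (by positivity)]
        push_cast
        nlinarith [(Nat.cast_nonneg n : (0 : ℝ) ≤ n)]
      · positivity
    · apply Finset.prod_nonneg
      intros
      positivity

lemma aux_seq_norm (x y : ℝ) (n : ℕ) (hn : 0 < n) :
    ‖Complex.GammaSeq (x + I * y) n‖ ^ 2 =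
      ((n : ℝ) ^ x * (n.factorial : ℝ)) ^ 2 /
        ∏ j ∈ Finset.range (n + 1), ((x + j : ℝ) ^ 2 + y ^ 2) := by
  unfold Complex.GammaSeq
  rw [norm_div, norm_mul, Complex.norm_natCast_cpow_of_pos hn, norm_prod, div_pow,
    ← Finset.prod_pow]
  congr 1
  · simp
  · apply Finset.prod_congr rfl
    intro j _
    rw [Complex.sq_norm, Complex.normSq_apply]
    simp
    ring

lemma aux_seq (y : ℝ) (hy : 1 / 4 ≤ y) (n : ℕ) (hn : 0 < n) :
    1 / 2 * (‖Complex.GammaSeq ((0 : ℝ) + I * y) n‖ ^ 2 *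
      ‖Complex.GammaSeq ((1 / 2 : ℝ) + I * y) n‖ ^ 2) ≤
      (‖Complex.GammaSeq ((1 / 4 : ℝ) + I * y) n‖ ^ 2) ^ 2 := by
  have hy0 : 0 < y := by linarith
  rw [aux_seq_norm _ _ _ hn, aux_seq_norm _ _ _ hn, aux_seq_norm _ _ _ hn]
  have hp := aux_prod y hy n
  rw [Finset.prod_pow, Finset.prod_mul_distrib] at hp
  simp only [zero_add]
  set A := ∏ j ∈ Finset.range (n + 1), ((j : ℝ) ^ 2 + y ^ 2) with hA
  set B := ∏ j ∈ Finset.range (n + 1), ((1 / 2 + j : ℝ) ^ 2 + y ^ 2) with hB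
  set C := ∏ j ∈ Finset.range (n + 1), ((1 / 4 + j : ℝ) ^ 2 + y ^ 2) with hC
  have pA : 0 < A := Finset.prod_pos fun j _ => by positivity
  have pB : 0 < B := Finset.prod_pos fun j _ => by positivity
  have pC : 0 < C := Finset.prod_pos fun j _ => by positivity
  have hn' : (0 : ℝ) < n := by exact_mod_cast hn
  have e : ((n : ℝ) ^ (1 / 2 : ℝ)) = ((n : ℝ) ^ (1 / 4 : ℝ)) ^ 2 := by
    rw [← Real.rpow_natCast, ← Real.rpow_mul hn'.le]
    norm_num
  rw [e, Real.rpow_zero]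
  set r := (n : ℝ) ^ (1 / 4 : ℝ)
  set f := (n.factorial : ℝ)
  have h1 : 1 / 2 * C ^ 2 ≤ A * B := by
    refine le_trans ?_ hp
    apply mul_le_mul_of_nonneg_right _ (by positivity)
    have : 1 ≤ (n + 2 : ℝ) / (n + 1) := by
      rw [le_div_iff₀ (by positivity)]; linarith
    linarith
  have e1 : 1 / 2 * ((1 * f) ^ 2 / A * ((r ^ 2 * f) ^ 2 / B)) =
      ((r * f) ^ 2) ^ 2 * (1 / 2) / (A * B) := by
    field_simp
  rw [e1, div_pow, div_le_div_iff₀ (by positivity) (by positivity)]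
  calc _ = ((r * f) ^ 2) ^ 2 * (1 / 2 * C ^ 2) := by ring
    _ ≤ _ := mul_le_mul_of_nonneg_left h1 (by positivity)

lemma aux_gamma4 (y : ℝ) (hy : 1 / 4 ≤ y) :
    1 / 2 * (‖Complex.Gamma (I * y)‖ ^ 2 * ‖Complex.Gamma (1 / 2 + I * y)‖ ^ 2) ≤
      (‖Complex.Gamma (1 / 4 + I * y)‖ ^ 2) ^ 2 := by
  have t0 := ((Complex.GammaSeq_tendsto_Gamma ((0 : ℝ) + I * y)).norm.pow 2)
  have t1 := ((Complex.GammaSeq_tendsto_Gamma ((1 / 2 : ℝ) + I * y)).norm.pow 2)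
  have t2 := (((Complex.GammaSeq_tendsto_Gamma ((1 / 4 : ℝ) + I * y)).norm.pow 2).pow 2)
  have := le_of_tendsto_of_tendsto ((t0.mul t1).const_mul (1 / 2)) t2
    (by filter_upwards [Filter.eventually_gt_atTop 0] with n hn using aux_seq y hy n hn)
  simpa using this

lemma aux_gamma (u : ℝ) (hu : 1 ≤ u) :
    u ^ (-(1 / 4) : ℝ) ≤
      ‖Complex.Gamma ((1 + 2 * I * u) / 4)‖ * Real.exp (Real.pi * u / 4) := by
  have hy : 1 / 4 ≤ u / 2 := by linarith
  have hy0 : 0 < u / 2 := by linarith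
  have h := aux_gamma4 (u / 2) hy
  have h0 := aux_zero (u / 2) hy0
  have h1 := aux_half (u / 2) hy0
  have e : ((1 : ℂ) + 2 * I * u) / 4 = 1 / 4 + I * ((u / 2 : ℝ) : ℂ) := by
    push_cast; ring
  rw [e]
  set G := ‖Complex.Gamma (1 / 4 + I * ((u / 2 : ℝ) : ℂ))‖
  have h2 := mul_le_mul h0 h1 (by positivity) (by positivity)
  have hE : (Real.exp (Real.pi * u / 4)) ^ 4 *
      (Real.exp (-(Real.pi * (u / 2))) * Real.exp (-(Real.pi * (u / 2)))) = 1 := by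
    rw [← Real.exp_nat_mul, ← Real.exp_add, ← Real.exp_add, Real.exp_eq_one_iff]
    push_cast; ring
  have hu0 : 0 < u := by linarith
  have hr : (u ^ (-(1 / 4) : ℝ)) ^ 4 = u⁻¹ := by
    rw [← Real.rpow_natCast, ← Real.rpow_mul hu0.le, ← Real.rpow_neg_one]
    norm_num
  refine le_of_pow_le_pow_left₀ (n := 4) (by norm_num) (by positivity) ?_
  rw [hr, mul_pow]
  have h3 : 1 / 2 * (Real.pi * Real.exp (-(Real.pi * (u / 2))) / (u / 2) *
      (Real.pi * Real.exp (-(Real.pi * (u / 2))))) ≤ G ^ 4 := by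
    calc _ ≤ _ := mul_le_mul_of_nonneg_left h2 (by norm_num)
      _ ≤ _ := h
      _ = _ := by ring
  set E := Real.exp (Real.pi * u / 4)
  set F := Real.exp (-(Real.pi * (u / 2)))
  calc u⁻¹ ≤ Real.pi ^ 2 * u⁻¹ := by
        have := Real.pi_gt_three
        have : 0 < u⁻¹ := by positivity
        exact le_mul_of_one_le_left this.le (by nlinarith [Real.pi_gt_three])
    _ = Real.pi ^ 2 * u⁻¹ * (E ^ 4 * (F * F)) := by rw [hE, mul_one]
    _ = 1 / 2 * (Real.pi * F / (u / 2) * (Real.pi * F)) * E ^ 4 := by field_simp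
    _ ≤ _ := mul_le_mul_of_nonneg_right h3 (by positivity)

lemma aux_Q_cont (a : ℝ) : Continuous fun u : ℝ => Qzeta (1 / 2 + I * u) a := by
  have hne : ∀ u : ℝ, (1 / 2 + I * u : ℂ) ≠ 1 := by
    intro u h
    have := congrArg Complex.re h
    norm_num at this
  have hc : Continuous fun u : ℝ => (1 / 2 + I * u : ℂ) := by fun_prop
  have hh : ∀ b : ℝ, Continuous fun u : ℝ => hzeta b (1 / 2 + I * u) := fun b =>
    continuous_iff_continuousAt.mpr fun u =>
      ContinuousAt.comp (f := fun u : ℝ => (1 / 2 + I * u : ℂ)) (g := hzeta b)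
        (HurwitzZeta.differentiableAt_hurwitzZeta _ (hne u)).continuousAt hc.continuousAt
  have hp : ∀ b : ℝ, Continuous fun u : ℝ => pzeta b (1 / 2 + I * u) := fun b =>
    continuous_iff_continuousAt.mpr fun u =>
      ContinuousAt.comp (f := fun u : ℝ => (1 / 2 + I * u : ℂ)) (g := pzeta b)
        (HurwitzZeta.differentiableAt_expZeta _ _ (Or.inl (hne u))).continuousAt hc.continuousAt
  unfold Qzeta
  exact ((((hh a).add (hh (1 - a))).add (hp a)).add (hp (1 - a))).div_const 2

/-- Lower bound for `J_a(t)` (Lemma 2.4). -/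
theorem Jfun_lower_bound (a : ℝ) (ha : 0 < a) (ha' : a ≤ 1 / 2) :
    ∃ c > (0 : ℝ), ∃ u₀ > (0 : ℝ), ∀ k δ t : ℝ, 0 < k → 0 < δ → u₀ ≤ t - k →
      c * (t + k) ^ (-(1 / 4) : ℝ) * Real.exp (-(t + k) * δ / 2) *
          ∫ u in (t - k)..(t + k), ‖(Qzeta (1 / 2 + Complex.I * u) a)‖ ≤
        Jfun a k δ t := by
  refine ⟨1 / (2 * Real.pi) * Real.pi ^ (-(1 / 4) : ℝ), by positivity, 1, one_pos, ?_⟩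
  intro k δ t hk hδ ht
  unfold Jfun
  rw [mul_assoc, mul_assoc, mul_assoc]
  refine mul_le_mul_of_nonneg_left ?_ (by positivity)
  rw [← mul_assoc, ← mul_assoc, ← intervalIntegral.integral_const_mul]
  have hQ := aux_Q_cont a
  have hG : Continuous fun u : ℝ => Complex.Gamma ((1 + 2 * I * u) / 4) := by
    rw [continuous_iff_continuousAt]
    intro u
    refine ContinuousAt.comp (f := fun u : ℝ => ((1 + 2 * I * u) / 4 : ℂ)) (g := Complex.Gamma)
      (Complex.differentiableAt_Gamma _ ?_).continuousAt
      (by fun_prop)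
    intro m h
    have := congrArg Complex.re h
    have h4 : (((1 : ℂ) + 2 * I * u) / 4).re = 1 / 4 := by
      have : ((1 : ℂ) + 2 * I * u) / 4 = ((1 / 4 : ℝ) : ℂ) + ((u / 2 : ℝ) : ℂ) * I := by
        push_cast; ring
      rw [this, aux_re]
    rw [h4] at this
    simp at this
    have hm : (0 : ℝ) ≤ m := Nat.cast_nonneg m
    linarith
  have hP : Continuous fun u : ℝ => (Real.pi : ℂ) ^ (-(1 : ℂ) / 4 - Complex.I * u / 4) :=
    Continuous.const_cpow (by fun_prop) (Or.inl (by exact_mod_cast Real.pi_ne_zero))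
  apply intervalIntegral.integral_mono_on (by linarith)
  · exact (hQ.norm.const_mul _ ).intervalIntegrable _ _
  · apply Continuous.intervalIntegrable
    exact ((((hP.mul hG).mul hQ).mul (by fun_prop)).mul (by fun_prop)).norm
  · intro u hu
    have hu1 : 1 ≤ u := le_trans ht hu.1
    have hu0 : 0 < u := by linarith
    have hg := aux_gamma u hu1
    have n1 : ‖(Real.pi : ℂ) ^ (-(1 : ℂ) / 4 - Complex.I * u / 4)‖ =
        Real.pi ^ (-(1 / 4) : ℝ) := by
      rw [Complex.norm_cpow_eq_rpow_re_of_pos Real.pi_pos]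
      congr 1
      have : -(1 : ℂ) / 4 - Complex.I * u / 4 =
          ((-(1 / 4) : ℝ) : ℂ) + ((-u / 4 : ℝ) : ℂ) * I := by
        push_cast; ring
      rw [this, aux_re]
    have n2 : ‖Complex.exp (Real.pi * u / 4)‖ = Real.exp (Real.pi * u / 4) := by
      rw [← Complex.norm_exp_ofReal]; push_cast; rfl
    have n3 : ‖Complex.exp (-u * δ / 2)‖ = Real.exp (-u * δ / 2) := by
      rw [← Complex.norm_exp_ofReal]; push_cast; rfl
    rw [norm_mul, norm_mul, norm_mul, norm_mul, n1, n2, n3]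
    have hr : (t + k) ^ (-(1 / 4) : ℝ) ≤ u ^ (-(1 / 4) : ℝ) :=
      Real.rpow_le_rpow_of_nonpos hu0 hu.2 (by norm_num)
    have he : Real.exp (-(t + k) * δ / 2) ≤ Real.exp (-u * δ / 2) := by
      apply Real.exp_le_exp.mpr
      nlinarith [hu.2]
    have hm := mul_le_mul (hr.trans hg) he (by positivity) (by positivity)
    have hp : 0 ≤ Real.pi ^ (-(1 / 4) : ℝ) * ‖Qzeta (1 / 2 + I * u) a‖ := by positivity
    have := mul_le_mul_of_nonneg_left hm hp
    linarith
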